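/- arXiv:1407.7998 — 6 statements merged into one kernel-verified Lean document; each statement's English description precedes it below -/
import Mathlib

section
/- Let J be a nonempty instance of jobs. For a finite nonempty set I of integer time slots contained in [0, d_max), where d_max = max_{j∈J} d_j, define the contribution of job j to I as Γ_j(I) = max(0, |I ∩ [r_j, d_j)| − ℓ_j), and define the strong density ρ_s(J) = max over all finite nonempty sets I of integer slots in [0, d_max) of (Σ_{j∈J} Γ_j(I)) / |I|. Then the minimum number of machines m(J) on which J admits a feasible preemptive schedule equals ⌈ρ_s(J)⌉. -/
/-- A job with release date `r`, deadline `d`, and processing time `p`. -/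
structure Job where
  r : ℕ
  d : ℕ
  p : ℕ

/-- A job is valid if `1 ≤ p` and `p ≤ d - r` (i.e. `r + p ≤ d`). -/
def Job.valid (j : Job) : Prop := 1 ≤ j.p ∧ j.r + j.p ≤ j.d

/-- The laxity `ℓ_j = d_j - r_j - p_j` of a job. -/
def Job.lax (j : Job) : ℕ := j.d - j.r - j.p

/-- A preemptive schedule of the instance `J` is feasible on `m` machines if at most `m`
jobs are processed in every slot, every job is only processed inside its window, and
every job is processed for exactly `p_j` slots. -/
def FeasiblePre {n : ℕ} (J : Fin n → Job) (m : ℕ) : Prop :=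
  ∃ S : ℕ → Finset (Fin n),
    (∀ t, (S t).card ≤ m) ∧
    (∀ t j, j ∈ S t → (J j).r ≤ t ∧ t < (J j).d) ∧
    (∀ j, ((Finset.range (J j).d).filter (fun t => j ∈ S t)).card = (J j).p)

/-- The minimum number of machines on which `J` admits a feasible preemptive schedule. -/
noncomputable def mOpt {n : ℕ} (J : Fin n → Job) : ℕ := sInf {m | FeasiblePre J m}

/-- The contribution `Γ_j(I) = max(0, |I ∩ [r_j, d_j)| - ℓ_j)` of job `j` to the set
`I` of integer time slots (natural subtraction is truncated). -/
def contrib {n : ℕ} (J : Fin n → Job) (j : Fin n) (I : Finset ℕ) : ℕ :=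
  (I.filter (fun t => (J j).r ≤ t ∧ t < (J j).d)).card - (J j).lax

open Finset in
/-- On a feasible schedule, every set of slots carries at least its contribution. -/
theorem FeasiblePre.sum_contrib_le {n : ℕ} {J : Fin n → Job} (hval : ∀ j, (J j).valid) {m : ℕ}
    (h : FeasiblePre J m) (I : Finset ℕ) : ∑ j, contrib J j I ≤ m * #I := by
  obtain ⟨S, hm, hw, hp⟩ := h
  have key : ∀ j, contrib J j I ≤ #{t ∈ I | j ∈ S t} := by
    intro j
    obtain ⟨-, hj⟩ := hval j
    have hsub : {t ∈ range (J j).d | j ∈ S t} ⊆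
        {t ∈ I | j ∈ S t} ∪ (Ico (J j).r (J j).d \ I) := by
      intro t ht
      have := hw t j
      simp only [mem_filter, mem_range, mem_union, mem_sdiff, mem_Ico] at ht ⊢
      tauto
    have h1 := (card_le_card hsub).trans (card_union_le _ _)
    have h2 := card_sdiff_add_card_inter (Ico (J j).r (J j).d) I
    have h3 : Ico (J j).r (J j).d ∩ I = {t ∈ I | (J j).r ≤ t ∧ t < (J j).d} := by
      ext t
      simp only [mem_inter, mem_Ico, mem_filter]
      tauto
    rw [hp] at h1
    rw [h3, Nat.card_Ico] at h2
    unfold contrib Job.lax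
    omega
  calc ∑ j, contrib J j I ≤ ∑ j, #{t ∈ I | j ∈ S t} := sum_le_sum fun j _ => key j
    _ = ∑ t ∈ I, #(S t) := by
      simp_rw [card_filter]
      rw [sum_comm]
      refine sum_congr rfl fun t _ => ?_
      simp
    _ ≤ ∑ _t ∈ I, m := sum_le_sum fun t _ => hm t
    _ = m * #I := by simp [mul_comm]

open Finset in
/-- If no set of slots is overloaded by contributions, there is a feasible schedule: apply
Hall's theorem, matching every pair of a job and a slot in its window either to a machine
in that slot or to a unit of the job's laxity. -/
theorem feasiblePre_of_sum_contrib_le {n : ℕ} {J : Fin n → Job} (hval : ∀ j, (J j).valid) {m : ℕ}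
    (h : ∀ I ⊆ range (univ.sup fun j => (J j).d), ∑ j, contrib J j I ≤ m * #I) :
    FeasiblePre J m := by
  classical
  let ι := {x : Fin n × ℕ // (J x.1).r ≤ x.2 ∧ x.2 < (J x.1).d}
  let N : ι → Finset ((ℕ × ℕ) ⊕ (Σ _ : Fin n, ℕ)) := fun x =>
    ({x.1.2} ×ˢ range m).disjSum (({x.1.1} : Finset (Fin n)).sigma fun j => range (J j).lax)
  have hall : ∀ X : Finset ι, #X ≤ #(X.biUnion N) := by
    intro X
    let I : Finset ℕ := X.image fun x => x.1.2
    let A : Finset (Fin n) := X.image fun x => x.1.1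
    have hI : I ⊆ range (univ.sup fun j => (J j).d) := by
      intro t ht
      obtain ⟨x, -, rfl⟩ := mem_image.1 ht
      exact mem_range.2 (x.2.2.trans_le (le_sup (f := fun j => (J j).d) (mem_univ x.1.1)))
    have h1 : #X ≤ ∑ j ∈ A, #{t ∈ I | (J j).r ≤ t ∧ t < (J j).d} := by
      rw [← card_sigma]
      refine card_le_card_of_injOn (fun x => ⟨x.1.1, x.1.2⟩) (fun x hx => ?_) ?_
      · exact mem_sigma.2 ⟨mem_image_of_mem _ hx,
          mem_filter.2 ⟨mem_image_of_mem (fun x : ι => x.1.2) hx, x.2⟩⟩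
      · rintro ⟨⟨a, b⟩, hx⟩ - ⟨⟨c, d⟩, hy⟩ - hxy
        have hac : a = c ∧ b = d := by simpa using hxy
        exact Subtype.ext (Prod.ext hac.1 hac.2)
    have h2 : (I ×ˢ range m).disjSum (A.sigma fun j => range (J j).lax) ⊆ X.biUnion N := by
      rintro (⟨t, k⟩ | ⟨j, k⟩) hz
      · simp only [inl_mem_disjSum, mem_product] at hz
        obtain ⟨x, hx, hxt⟩ := mem_image.1 hz.1
        exact mem_biUnion.2 ⟨x, hx, inl_mem_disjSum.2
          (mem_product.2 ⟨mem_singleton.2 hxt.symm, hz.2⟩)⟩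
      · simp only [inr_mem_disjSum, mem_sigma] at hz
        obtain ⟨x, hx, hxj⟩ := mem_image.1 hz.1
        exact mem_biUnion.2 ⟨x, hx, inr_mem_disjSum.2
          (mem_sigma.2 ⟨mem_singleton.2 hxj.symm, hz.2⟩)⟩
    calc #X ≤ ∑ j ∈ A, #{t ∈ I | (J j).r ≤ t ∧ t < (J j).d} := h1
      _ ≤ ∑ j ∈ A, (contrib J j I + (J j).lax) :=
        sum_le_sum fun j _ => by unfold contrib; omega
      _ = ∑ j ∈ A, contrib J j I + ∑ j ∈ A, (J j).lax := sum_add_distrib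
      _ ≤ #I * m + ∑ j ∈ A, (J j).lax := by
        have h3 : ∑ j ∈ A, contrib J j I ≤ ∑ j, contrib J j I :=
          sum_le_sum_of_subset (subset_univ A)
        have := h I hI
        rw [mul_comm] at this
        omega
      _ = #((I ×ˢ range m).disjSum (A.sigma fun j => range (J j).lax)) := by
        simp [card_disjSum, card_product, card_sigma]
      _ ≤ #(X.biUnion N) := card_le_card h2
  obtain ⟨f, hf, hfN⟩ := (all_card_le_biUnion_card_iff_exists_injective N).1 hall
  have hbusy : ∀ x a, f x = .inl a → a.1 = x.1.2 ∧ a.2 < m := by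
    intro x a hx
    have := hfN x
    rw [hx, inl_mem_disjSum, mem_product, mem_singleton, mem_range] at this
    exact this
  have hidle : ∀ x b, f x = .inr b → b.1 = x.1.1 ∧ b.2 < (J x.1.1).lax := by
    intro x b hx
    have := hfN x
    rw [hx, inr_mem_disjSum, mem_sigma, mem_singleton, mem_range] at this
    exact ⟨this.1, this.1 ▸ this.2⟩
  let P : Fin n → Finset ℕ := fun j =>
    {t ∈ Ico (J j).r (J j).d | ∃ hx : (J j).r ≤ t ∧ t < (J j).d, ∃ a, f ⟨(j, t), hx⟩ = .inl a}
  have hP : ∀ j, (J j).p ≤ #(P j) := by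
    intro j
    obtain ⟨-, hj⟩ := hval j
    have hc : #(Ico (J j).r (J j).d \ P j) ≤ #(range (J j).lax) := by
      have hex : ∀ t ∈ Ico (J j).r (J j).d \ P j, ∃ k ∈ range (J j).lax,
          ∃ hx : (J j).r ≤ t ∧ t < (J j).d, f ⟨(j, t), hx⟩ = .inr ⟨j, k⟩ := by
        intro t ht
        obtain ⟨ht1, ht2⟩ := mem_sdiff.1 ht
        have hx := mem_Ico.1 ht1
        rcases hfx : f ⟨(j, t), hx⟩ with a | ⟨i, k⟩
        · exact absurd (mem_filter.2 ⟨ht1, hx, a, hfx⟩) ht2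
        · obtain ⟨h1, h2⟩ := hidle _ _ hfx
          simp only at h1 h2
          subst h1
          exact ⟨k, mem_range.2 h2, hx, hfx⟩
      choose! g hg hgf using hex
      refine card_le_card_of_injOn g hg ?_
      intro s hs t ht hst
      obtain ⟨hxs, hs'⟩ := hgf s hs
      obtain ⟨hxt, ht'⟩ := hgf t ht
      rw [hst, ← ht'] at hs'
      exact congrArg (fun x : ι => x.1.2) (hf hs')
    have h1 : #(Ico (J j).r (J j).d \ P j) + #(P j) = #(Ico (J j).r (J j).d) :=
      card_sdiff_add_card_eq_card (filter_subset _ _)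
    rw [card_range] at hc
    rw [Nat.card_Ico] at h1
    unfold Job.lax at hc
    omega
  choose Q hQP hQ using fun j => exists_subset_card_eq (hP j)
  refine ⟨fun t => {j | t ∈ Q j}, fun t => ?_, fun t j hj => ?_, fun j => ?_⟩
  · have hex : ∀ j ∈ ({j | t ∈ Q j} : Finset (Fin n)), ∃ k ∈ range m,
        ∃ hx : (J j).r ≤ t ∧ t < (J j).d, f ⟨(j, t), hx⟩ = .inl (t, k) := by
      intro j hj
      obtain ⟨-, hx, ⟨s, k⟩, hfx⟩ := mem_filter.1 (hQP j (mem_filter.1 hj).2)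
      obtain ⟨h1, h2⟩ := hbusy _ _ hfx
      simp only at h1 h2
      subst h1
      exact ⟨k, mem_range.2 h2, hx, hfx⟩
    choose! g hg hgf using hex
    rw [← card_range m]
    refine card_le_card_of_injOn g hg ?_
    intro i hi j hj hij
    obtain ⟨hxi, hi'⟩ := hgf i hi
    obtain ⟨hxj, hj'⟩ := hgf j hj
    rw [hij, ← hj'] at hi'
    exact congrArg (fun x : ι => x.1.1) (hf hi')
  · exact mem_Ico.1 (mem_filter.1 (hQP j (mem_filter.1 hj).2)).1
  · rw [← hQ j]
    congr 1
    ext t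
    have : t ∈ Q j → t < (J j).d := fun ht => (mem_Ico.1 (mem_filter.1 (hQP j ht)).1).2
    simp only [mem_filter, mem_range, mem_univ, true_and]
    tauto

/-- For a nonempty instance `J`, the strong density
`ρ_s = max_I (∑_j Γ_j(I)) / |I|` (the maximum taken over all finite nonempty sets `I`
of integer slots contained in `[0, d_max)`) exists, and the minimum number of machines
on which `J` admits a feasible preemptive schedule equals `⌈ρ_s⌉`. -/
theorem mOpt_eq_ceil_strong_density {n : ℕ} (hn : 0 < n) (J : Fin n → Job)
    (hval : ∀ j, (J j).valid) :
    ∃ ρs : ℚ,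
      IsGreatest
        {q : ℚ | ∃ I : Finset ℕ, I.Nonempty ∧
          I ⊆ Finset.range (Finset.univ.sup (fun j => (J j).d)) ∧
          q = (∑ j, (contrib J j I : ℚ)) / (I.card : ℚ)} ρs ∧
      mOpt J = ⌈ρs⌉₊ := by
  set D := Finset.univ.sup fun j => (J j).d with hD
  have hD0 : 0 < D := by
    obtain ⟨h1, h2⟩ := hval ⟨0, hn⟩
    have := Finset.le_sup (f := fun j => (J j).d) (Finset.mem_univ (⟨0, hn⟩ : Fin n))
    omega
  set dens : Finset ℕ → ℚ := fun I => (∑ j, (contrib J j I : ℚ)) / (I.card : ℚ) with hdens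
  obtain ⟨I₀, hI₀, hmax⟩ := Finset.exists_max_image
    ((Finset.range D).powerset.filter Finset.Nonempty) dens
    ⟨Finset.range D, Finset.mem_filter.2
      ⟨Finset.mem_powerset_self _, Finset.nonempty_range_iff.2 hD0.ne'⟩⟩
  obtain ⟨hI₀D, hI₀ne⟩ := Finset.mem_filter.1 hI₀
  rw [Finset.mem_powerset] at hI₀D
  have hdens_le : ∀ I : Finset ℕ, I.Nonempty → ∀ m : ℕ,
      dens I ≤ m ↔ ∑ j, contrib J j I ≤ m * I.card := by
    intro I hI m
    rw [hdens, div_le_iff₀ (by exact_mod_cast hI.card_pos)]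
    exact_mod_cast Iff.rfl
  refine ⟨dens I₀, ⟨⟨I₀, hI₀ne, hI₀D, rfl⟩, ?_⟩, ?_⟩
  · rintro q ⟨I, hI, hID, rfl⟩
    exact hmax I (Finset.mem_filter.2 ⟨Finset.mem_powerset.2 hID, hI⟩)
  · have hset : {m | FeasiblePre J m} = Set.Ici ⌈dens I₀⌉₊ := by
      ext m
      rw [Set.mem_ofPred_eq, Set.mem_Ici, Nat.ceil_le]
      constructor
      · intro h
        exact (hdens_le I₀ hI₀ne m).2 (h.sum_contrib_le hval I₀)
      · intro h
        refine feasiblePre_of_sum_contrib_le hval fun I hID => ?_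
        rcases I.eq_empty_or_nonempty with rfl | hI
        · simp [contrib]
        · exact (hdens_le I hI m).1
            ((hmax I (Finset.mem_filter.2 ⟨Finset.mem_powerset.2 hID, hI⟩)).trans h)
    rw [mOpt, hset, csInf_Ici]
end

section
/- Let J be an instance in which every job is (1/2)-tight, i.e., p_j > (d_j − r_j)/2 for all j ∈ J, and let β ∈ (0,1) be rational such that (1−β)·ℓ_j is an integer for every j ∈ J. Define the instance J_β = {j_β : j ∈ J} where job j_β has the same window [r_j, d_j] as j and processing time p_{j_β} = p_j + (1−β)·ℓ_j (equivalently, laxity β·ℓ_j). Then m(J_β) ≤ (4/β)·m(J). -/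
open Finset in
/-- A Hall-type criterion for preemptive feasibility on `k` machines. -/
theorem feasiblePre_of_forall_sum_card_le {n : ℕ} (J : Fin n → Job) (k : ℕ)
    (hp : ∀ j, (J j).r + (J j).p ≤ (J j).d)
    (h : ∀ (I : Finset ℕ) (B : Finset (Fin n)),
      ∑ j ∈ B, #(I ∩ Ico (J j).r (J j).d) ≤ #I * k + ∑ j ∈ B, (J j).lax) :
    FeasiblePre J k := by
  classical
  -- Every pair (job, slot of its window) is matched to a machine slot or to an idle token.
  let X := {x : Fin n × ℕ // x.2 ∈ Ico (J x.1).r (J x.1).d}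
  let N : X → Finset ((ℕ × ℕ) ⊕ (Σ _ : Fin n, ℕ)) := fun x =>
    (({x.1.2} : Finset ℕ) ×ˢ range k).disjSum
      (({x.1.1} : Finset (Fin n)).sigma fun j => range (J j).lax)
  have hall : ∀ s : Finset X, #s ≤ #(s.biUnion N) := by
    intro s
    let I := s.image fun x => x.1.2
    let B := s.image fun x => x.1.1
    have h1 : #s ≤ #(B.sigma fun j => I ∩ Ico (J j).r (J j).d) := by
      refine card_le_card_of_injOn (fun x => ⟨x.1.1, x.1.2⟩) ?_ ?_
      · intro x hx
        have hx' : x ∈ s := hx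
        have h2 := x.2
        simp only [coe_sigma, Set.mem_sigma_iff, mem_coe, mem_inter]
        exact ⟨mem_image_of_mem _ hx', mem_image_of_mem _ hx', h2⟩
      · rintro ⟨⟨a, b⟩, _⟩ _ ⟨⟨c, d⟩, _⟩ _ hh
        simp only [Sigma.mk.injEq, heq_eq_eq] at hh
        simp [hh.1, hh.2]
    have h2 : (I ×ˢ range k).disjSum (B.sigma fun j => range (J j).lax) ⊆ s.biUnion N := by
      intro y hy
      rw [mem_disjSum] at hy
      rcases hy with ⟨⟨t, c⟩, hy, rfl⟩ | ⟨⟨j, c⟩, hy, rfl⟩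
      · rw [mem_product] at hy
        obtain ⟨x, hx, hxt⟩ := mem_image.1 hy.1
        refine mem_biUnion.2 ⟨x, hx, inl_mem_disjSum.2 (mem_product.2 ⟨?_, hy.2⟩)⟩
        exact mem_singleton.2 hxt.symm
      · rw [mem_sigma] at hy
        obtain ⟨x, hx, hxt⟩ := mem_image.1 hy.1
        refine mem_biUnion.2 ⟨x, hx, inr_mem_disjSum.2 (mem_sigma.2 ⟨?_, hy.2⟩)⟩
        exact mem_singleton.2 hxt.symm
    have h3 := card_le_card h2
    rw [card_disjSum, card_product, card_range, card_sigma] at h3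
    rw [card_sigma] at h1
    simp only [card_range] at h3
    exact h1.trans ((h I B).trans h3)
  obtain ⟨f, hf, hfN⟩ := (all_card_le_biUnion_card_iff_exists_injective N).1 hall
  let R : Fin n → Finset ℕ := fun j => (Ico (J j).r (J j).d).filter fun t =>
    ∃ (ht : t ∈ Ico (J j).r (J j).d) (y : ℕ × ℕ), f ⟨(j, t), ht⟩ = Sum.inl y
  have hR : ∀ j, (J j).p ≤ #(R j) := by
    intro j
    let Z : Finset ℕ := (Ico (J j).r (J j).d).filter fun t =>
      ¬ ∃ (ht : t ∈ Ico (J j).r (J j).d) (y : ℕ × ℕ), f ⟨(j, t), ht⟩ = Sum.inl y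
    have h1 : #(R j) + #Z = (J j).d - (J j).r := by
      rw [← Nat.card_Ico]; exact card_filter_add_card_filter_not _
    have hZ : ∀ t ∈ Z, ∃ (ht : t ∈ Ico (J j).r (J j).d) (c : ℕ),
        c < (J j).lax ∧ f ⟨(j, t), ht⟩ = Sum.inr ⟨j, c⟩ := by
      intro t ht
      obtain ⟨ht, hn⟩ := mem_filter.1 ht
      refine ⟨ht, ?_⟩
      have hm := hfN ⟨(j, t), ht⟩
      rcases hy : f ⟨(j, t), ht⟩ with y | ⟨j', c⟩
      · exact absurd ⟨ht, y, hy⟩ hn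
      · rw [hy] at hm
        have hm := mem_sigma.1 (inr_mem_disjSum.1 hm)
        have hj : j' = j := mem_singleton.1 hm.1
        subst hj
        exact ⟨c, mem_range.1 hm.2, rfl⟩
    choose! hw c hc hfc using hZ
    have h2 : #Z ≤ #(range (J j).lax) := by
      refine card_le_card_of_injOn c (fun t ht => by
        simpa using hc t ht) ?_
      intro t ht t' ht' hcc
      have e := (hfc t ht).trans ((congrArg (fun c => (Sum.inr ⟨j, c⟩ : (ℕ × ℕ) ⊕ (Σ _ : Fin n, ℕ))) hcc).trans
        (hfc t' ht').symm)
      have e := congrArg (fun x : X => x.1.2) (hf e)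
      exact e
    rw [card_range] at h2
    have h3 := hp j
    unfold Job.lax at h2
    omega
  choose P hPR hPc using fun j => exists_subset_card_eq (hR j)
  have hPw : ∀ {j t}, t ∈ P j → t ∈ Ico (J j).r (J j).d := fun ht =>
    (mem_filter.1 (hPR _ ht)).1
  refine ⟨fun t => univ.filter fun j => t ∈ P j, fun t => ?_, fun t j hj => ?_, fun j => ?_⟩
  · have hS : ∀ j ∈ univ.filter fun j => t ∈ P j, ∃ (ht : t ∈ Ico (J j).r (J j).d) (c : ℕ),
        c < k ∧ f ⟨(j, t), ht⟩ = Sum.inl (t, c) := by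
      intro j hj
      obtain ⟨_, ht, ⟨t', c⟩, hy⟩ := mem_filter.1 (hPR _ (mem_filter.1 hj).2)
      have hm := hfN ⟨(j, t), ht⟩
      rw [hy] at hm
      have hm := mem_product.1 (inl_mem_disjSum.1 hm)
      have ht' : t' = t := mem_singleton.1 hm.1
      subst ht'
      exact ⟨ht, c, mem_range.1 hm.2, hy⟩
    choose! hw c hc hfc using hS
    rw [← card_range k]
    refine card_le_card_of_injOn c (fun j hj => by
        simpa using hc j hj) ?_
    intro j hj j' hj' hcc
    have e := (hfc j hj).trans ((congrArg (fun c => (Sum.inl (t, c) : (ℕ × ℕ) ⊕ (Σ _ : Fin n, ℕ))) hcc).trans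
        (hfc j' hj').symm)
    have e := congrArg (fun x : X => x.1.1) (hf e)
    exact e
  · exact mem_Ico.1 (hPw (mem_filter.1 hj).2)
  · rw [← hPc j]
    congr 1
    ext t
    simp only [mem_filter, mem_range, mem_univ, true_and, and_iff_right_iff_imp]
    exact fun ht => (mem_Ico.1 (hPw ht)).2

/-- Every valid instance with `n` jobs is feasible on `n` machines. -/
theorem feasiblePre_card {n : ℕ} (J : Fin n → Job) (hp : ∀ j, (J j).r + (J j).p ≤ (J j).d) :
    FeasiblePre J n := by
  refine feasiblePre_of_forall_sum_card_le J n hp fun I B => ?_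
  calc ∑ j ∈ B, (I ∩ Finset.Ico (J j).r (J j).d).card
      ≤ ∑ _j ∈ B, I.card :=
        Finset.sum_le_sum fun j _ => Finset.card_le_card Finset.inter_subset_left
    _ = B.card * I.card := by simp
    _ ≤ n * I.card := Nat.mul_le_mul_right _ (by simpa using Finset.card_le_univ B)
    _ ≤ _ := by rw [mul_comm]; exact Nat.le_add_right _ _

/-- Backlog of a queue with arrivals `a` and service rate `β`. -/
def backlog (β : ℚ) (a : ℕ → ℚ) : ℕ → ℚ
  | 0 => 0
  | t + 1 => max 0 (backlog β a t + a t - β)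

theorem backlog_nonneg (β : ℚ) (a : ℕ → ℚ) (t : ℕ) : 0 ≤ backlog β a t := by
  cases t with
  | zero => exact le_rfl
  | succ t => exact le_max_left _ _

/-- Spreading the mass `a / β` to the right with density at most one. -/
theorem exists_spread_right {β : ℚ} (hβ0 : 0 < β) (hβ1 : β < 1) {a : ℕ → ℚ}
    (ha : ∀ t, a t = 0 ∨ a t = 1) :
    ∃ u : ℕ → ℚ, (∀ t, 0 ≤ u t) ∧ (∀ t, u t ≤ 1) ∧ (∀ t, a t = 1 → u t = 1) ∧
      (∀ N, β * ∑ t ∈ Finset.range N, u t ≤ ∑ t ∈ Finset.range N, a t) ∧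
      ∀ r t, r ≤ t → u t < 1 →
        ∑ i ∈ Finset.Ico r (t + 1), a i ≤ β * ∑ i ∈ Finset.Ico r (t + 1), u i := by
  have ha0 : ∀ t, 0 ≤ a t := fun t => by rcases ha t with h | h <;> norm_num [h]
  have hq := backlog_nonneg β a
  have hsucc : ∀ t, backlog β a (t + 1) = max 0 (backlog β a t + a t - β) := fun t => rfl
  have hmul : ∀ t, β * ((backlog β a t + a t - backlog β a (t + 1)) / β)
      = a t - (backlog β a (t + 1) - backlog β a t) := fun t => by
    field_simp; ring
  refine ⟨fun t => (backlog β a t + a t - backlog β a (t + 1)) / β, fun t => ?_, fun t => ?_,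
    fun t h1 => ?_, fun N => ?_, fun r t hrt hlt => ?_⟩
  · refine div_nonneg ?_ hβ0.le
    rw [hsucc, sub_nonneg]
    have := hq t; have := ha0 t
    exact max_le (by linarith) (by linarith)
  · rw [div_le_one hβ0, hsucc]
    linarith [le_max_right 0 (backlog β a t + a t - β)]
  · rw [div_eq_one_iff_eq hβ0.ne', hsucc, max_eq_right (by linarith [hq t])]
    ring
  · rw [Finset.mul_sum, Finset.sum_congr rfl fun t _ => hmul t, Finset.sum_sub_distrib,
      Finset.sum_range_sub]
    have h0 : backlog β a 0 = 0 := rfl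
    linarith [hq N]
  · have h0 : backlog β a (t + 1) = 0 := by
      rw [div_lt_one hβ0] at hlt
      rw [hsucc] at hlt ⊢
      rcases max_cases 0 (backlog β a t + a t - β) with h | h
      · exact h.1
      · rw [h.1] at hlt; linarith
    rw [Finset.mul_sum, Finset.sum_congr rfl fun t _ => hmul t, Finset.sum_sub_distrib,
      Finset.sum_Ico_sub _ (by omega), h0]
    linarith [hq r]

/-- Mirror image of `exists_spread_right` inside `{0, …, T}`. -/
theorem exists_spread_left {β : ℚ} (hβ0 : 0 < β) (hβ1 : β < 1) {a : ℕ → ℚ}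
    (ha : ∀ t, a t = 0 ∨ a t = 1) (T : ℕ) :
    ∃ u : ℕ → ℚ, (∀ t, 0 ≤ u t) ∧ (∀ t, u t ≤ 1) ∧ (∀ t ≤ T, a t = 1 → u t = 1) ∧
      β * ∑ t ∈ Finset.range (T + 1), u t ≤ ∑ t ∈ Finset.range (T + 1), a t ∧
      ∀ t d, t < d → d ≤ T + 1 → u t < 1 →
        ∑ i ∈ Finset.Ico t d, a i ≤ β * ∑ i ∈ Finset.Ico t d, u i := by
  obtain ⟨u, h0, h1, h2, h3, h4⟩ :=
    exists_spread_right hβ0 hβ1 (a := fun t => a (T - t)) fun t => ha _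
  refine ⟨fun t => u (T - t), fun t => h0 _, fun t => h1 _, fun t ht hat => h2 _ ?_, ?_,
    fun t d htd hd hlt => ?_⟩
  · simpa [Nat.sub_sub_self ht] using hat
  · have := h3 (T + 1)
    rw [Finset.sum_flip a] at this
    rwa [Finset.sum_flip u]
  · have h := h4 (T + 1 - d) (T - t) (by omega) hlt
    have e : T - t + 1 = T + 1 - t := by omega
    rw [e, Finset.sum_Ico_reflect a _ (by omega)] at h
    rw [Finset.sum_Ico_reflect u _ hd]
    have e1 : T + 1 - (T + 1 - t) = t := by omega
    have e2 : T + 1 - (T + 1 - d) = d := by omega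
    rwa [e1, e2] at h

/-- Two-sided spreading: every interval is either saturated or holds the full mass `a / β`. -/
theorem exists_spread {β : ℚ} (hβ0 : 0 < β) (hβ1 : β < 1) {a : ℕ → ℚ}
    (ha : ∀ t, a t = 0 ∨ a t = 1) (T : ℕ) :
    ∃ w : ℕ → ℚ, (∀ t, 0 ≤ w t) ∧ (∀ t, w t ≤ 1) ∧
      β * ∑ t ∈ Finset.range (T + 1), w t ≤ (2 - β) * ∑ t ∈ Finset.range (T + 1), a t ∧
      ∀ r d, d ≤ T + 1 → (∀ t ∈ Finset.Ico r d, w t = 1) ∨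
        ∑ i ∈ Finset.Ico r d, a i ≤ β * ∑ i ∈ Finset.Ico r d, w i := by
  obtain ⟨u, u0, u1, u2, u3, u4⟩ := exists_spread_right hβ0 hβ1 ha
  obtain ⟨v, v0, v1, v2, v3, v4⟩ := exists_spread_left hβ0 hβ1 ha T
  refine ⟨fun t => min 1 (u t + v t), fun t => le_min zero_le_one (add_nonneg (u0 t) (v0 t)),
    fun t => min_le_left _ _, ?_, fun r d hd => ?_⟩
  · have h : ∑ t ∈ Finset.range (T + 1), min 1 (u t + v t)
        ≤ ∑ t ∈ Finset.range (T + 1), (u t + v t - a t) := by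
      refine Finset.sum_le_sum fun t ht => ?_
      rcases ha t with h | h
      · rw [h, sub_zero]; exact min_le_right _ _
      · rw [u2 t h, v2 t (by simpa [Nat.lt_succ_iff] using ht) h, h]
        norm_num
    rw [Finset.sum_sub_distrib, Finset.sum_add_distrib] at h
    have := mul_le_mul_of_nonneg_left h hβ0.le
    linarith [u3 (T + 1)]
  · rw [or_iff_not_imp_left]
    intro hne
    push Not at hne
    obtain ⟨t, ht, hw⟩ := hne
    obtain ⟨hrt, htd⟩ := Finset.mem_Ico.1 ht
    have hlt : u t + v t < 1 := by
      by_contra hcon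
      exact hw (min_eq_left (not_lt.1 hcon))
    have hu := u4 r t hrt (by linarith [v0 t])
    have hv := v4 t d htd hd (by linarith [u0 t])
    have hau : ∀ i, u i ≤ min 1 (u i + v i) := fun i =>
      le_min (u1 i) (by linarith [v0 i])
    have hav : ∀ i, v i ≤ min 1 (u i + v i) := fun i =>
      le_min (v1 i) (by linarith [u0 i])
    have hsplit : ∀ f : ℕ → ℚ, ∑ i ∈ Finset.Ico r d, f i
        = ∑ i ∈ Finset.Ico r t, f i + f t + ∑ i ∈ Finset.Ico (t + 1) d, f i := fun f => by
      rw [← Finset.sum_Ico_succ_top hrt, Finset.sum_Ico_consecutive _ (by omega) (by omega)]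
    have hbot : ∀ f : ℕ → ℚ, ∑ i ∈ Finset.Ico t d, f i
        = f t + ∑ i ∈ Finset.Ico (t + 1) d, f i := fun f => Finset.sum_eq_sum_Ico_succ_bot htd f
    rw [Finset.sum_Ico_succ_top hrt, Finset.sum_Ico_succ_top hrt] at hu
    rw [hbot, hbot] at hv
    rw [hsplit, hsplit, min_eq_right hlt.le]
    have s1 := Finset.sum_le_sum fun i (_ : i ∈ Finset.Ico r t) => hau i
    have s2 := Finset.sum_le_sum fun i (_ : i ∈ Finset.Ico (t + 1) d) => hav i
    have hat : 0 ≤ a t := by rcases ha t with h | h <;> norm_num [h]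
    have s3 := mul_le_mul_of_nonneg_left (add_le_add s1 s2) hβ0.le
    linarith

/-- Let every job of `J` be `(1/2)`-tight (`p_j > (d_j - r_j)/2`) and
let `β ∈ (0,1)` be rational with `(1-β)·ℓ_j ∈ ℕ` for every `j` (witnessed by `L j`).
The instance `J_β` keeps every window `[r_j, d_j]` and enlarges the processing time to
`p_j + (1-β)·ℓ_j` (equivalently, the laxity shrinks to `β·ℓ_j`). Then
`m(J_β) ≤ (4/β)·m(J)`. -/
theorem laxity_drop {n : ℕ} (J : Fin n → Job) (hval : ∀ j, (J j).valid)
    (htight : ∀ j, ((J j).d : ℚ) - ((J j).r : ℚ) < 2 * ((J j).p : ℚ))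
    (β : ℚ) (hβ0 : 0 < β) (hβ1 : β < 1)
    (L : Fin n → ℕ) (hL : ∀ j, (L j : ℚ) = (1 - β) * ((J j).lax : ℚ)) :
    (mOpt (fun j => Job.mk (J j).r (J j).d ((J j).p + L j)) : ℚ)
      ≤ (4 / β) * (mOpt J : ℚ) := by
  classical
  have hfeas : FeasiblePre J (mOpt J) :=
    Nat.sInf_mem (s := {m | FeasiblePre J m}) ⟨n, feasiblePre_card J fun j => (hval j).2⟩
  set m := mOpt J
  obtain ⟨S, hSm, hSw, hSp⟩ := hfeas
  have hk0 : 0 ≤ 4 / β * (m : ℚ) := by positivity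
  have hLle : ∀ j, L j ≤ (J j).lax := fun j => by
    have h := hL j
    have h0 : (0 : ℚ) ≤ (J j).lax := Nat.cast_nonneg _
    have : (L j : ℚ) ≤ (J j).lax := by nlinarith
    exact_mod_cast this
  refine le_trans ?_ (Nat.floor_le hk0)
  refine Nat.cast_le.2 (Nat.sInf_le ?_)
  refine feasiblePre_of_forall_sum_card_le _ _ (fun j => ?_) fun I B => ?_
  · have h1 := hLle j
    have h2 := (hval j).2
    unfold Job.lax at h1
    simp only
    omega
  have hlax' : ∀ j, ((Job.lax ⟨(J j).r, (J j).d, (J j).p + L j⟩ : ℕ) : ℚ)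
      = β * (J j).lax := fun j => by
    have h1 := hLle j
    have h2 : Job.lax ⟨(J j).r, (J j).d, (J j).p + L j⟩ = (J j).lax - L j := by
      unfold Job.lax; simp only; omega
    rw [h2, Nat.cast_sub h1, hL j]; ring
  let a : ℕ → ℚ := fun t => if t ∈ I then 1 else 0
  have hsum : ∀ s : Finset ℕ, ∑ t ∈ s, a t = ((I ∩ s).card : ℚ) := fun s => by
    simp [a, Finset.inter_comm]
  let T := ∑ j, (J j).d
  have hT : ∀ j, (J j).d ≤ T := fun j =>
    Finset.single_le_sum (f := fun j => (J j).d) (fun _ _ => Nat.zero_le _) (Finset.mem_univ j)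
  obtain ⟨w, w0, w1, wsum, wI⟩ := exists_spread hβ0 hβ1 (a := a)
    (fun t => by by_cases h : t ∈ I <;> simp [a, h]) T
  let P : Fin n → Finset ℕ := fun j => (Finset.range (J j).d).filter fun t => j ∈ S t
  have hPW : ∀ j, P j ⊆ Finset.Ico (J j).r (J j).d := fun j t ht =>
    Finset.mem_Ico.2 (hSw t j (Finset.mem_filter.1 ht).2)
  have hjob : ∀ j, ((I ∩ Finset.Ico (J j).r (J j).d).card : ℚ) - β * (J j).lax
      ≤ 2 * ∑ t ∈ P j, w t := by
    intro j
    have hrd : (J j).r ≤ (J j).d := by have := (hval j).2; omega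
    have hlax0 : (0 : ℚ) ≤ (J j).lax := Nat.cast_nonneg _
    rcases wI (J j).r (J j).d ((hT j).trans (Nat.le_succ _)) with h | h
    · have h1 : ∑ t ∈ P j, w t = (J j).p := by
        rw [Finset.sum_congr rfl fun t ht => h t (hPW j ht)]
        simp [P, hSp j]
      have h2 : ((I ∩ Finset.Ico (J j).r (J j).d).card : ℚ) ≤ (J j).d - (J j).r := by
        rw [← Nat.cast_sub hrd, ← Nat.card_Ico]
        exact Nat.cast_le.2 (Finset.card_le_card Finset.inter_subset_right)
      have h3 := htight j
      rw [h1]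
      have := mul_nonneg hβ0.le hlax0
      linarith
    · rw [hsum] at h
      have h1 : ∑ t ∈ Finset.Ico (J j).r (J j).d \ P j, w t ≤ (J j).lax := by
        refine (Finset.sum_le_card_nsmul _ _ 1 fun t _ => w1 t).trans ?_
        rw [Finset.card_sdiff_of_subset (hPW j), Nat.card_Ico, show (P j).card = _ from hSp j]
        simp [Job.lax]
      have h2 := Finset.sum_sdiff (f := w) (hPW j)
      have h3 : 0 ≤ ∑ t ∈ P j, w t := Finset.sum_nonneg fun t _ => w0 t
      nlinarith
  have hswap : ∑ j, ∑ t ∈ P j, w t ≤ m * ∑ t ∈ Finset.range (T + 1), w t := by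
    have h1 : ∀ j, ∑ t ∈ P j, w t
        = ∑ t ∈ Finset.range (T + 1), if j ∈ S t then w t else 0 := fun j => by
      rw [← Finset.sum_filter]
      refine Finset.sum_congr ?_ fun _ _ => rfl
      ext t
      simp only [P, Finset.mem_filter, Finset.mem_range]
      have := hT j
      exact ⟨fun h => ⟨by omega, h.2⟩, fun h => ⟨(hSw t j h.2).2, h.2⟩⟩
    rw [Finset.sum_congr rfl fun j _ => h1 j, Finset.sum_comm, Finset.mul_sum]
    refine Finset.sum_le_sum fun t _ => ?_
    rw [← Finset.sum_filter]
    simp only [Finset.filter_mem_eq_inter, Finset.univ_inter, Finset.sum_const, nsmul_eq_mul]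
    exact mul_le_mul_of_nonneg_right (Nat.cast_le.2 (hSm t)) (w0 t)
  have hB : ∑ j ∈ B, ∑ t ∈ P j, w t ≤ ∑ j, ∑ t ∈ P j, w t :=
    Finset.sum_le_univ_sum_of_nonneg fun j => Finset.sum_nonneg fun t _ => w0 t
  have hwI : ∑ t ∈ Finset.range (T + 1), w t ≤ (2 - β) / β * I.card := by
    have h1 : ∑ t ∈ Finset.range (T + 1), a t ≤ I.card := by
      rw [hsum]; exact Nat.cast_le.2 (Finset.card_le_card Finset.inter_subset_left)
    have h2 := wsum.trans (mul_le_mul_of_nonneg_left h1 (by linarith))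
    rw [div_mul_eq_mul_div, le_div_iff₀ hβ0]
    linarith
  have hfloor : 2 * (m * ((2 - β) / β)) ≤ (⌊4 / β * (m : ℚ)⌋₊ : ℚ) := by
    have h1 : 2 * (m * ((2 - β) / β)) = 4 / β * (m : ℚ) - 2 * m := by field_simp; ring
    rcases Nat.eq_zero_or_pos m with h | h
    · simp [h]
    · have h2 : (1 : ℚ) ≤ m := by exact_mod_cast h
      have h3 := Nat.lt_floor_add_one (4 / β * (m : ℚ))
      linarith
  have hmain := Finset.sum_le_sum fun j (_ : j ∈ B) => hjob j
  rw [Finset.sum_sub_distrib, ← Finset.mul_sum B (fun j => ∑ t ∈ P j, w t)] at hmain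
  have hm := mul_le_mul_of_nonneg_left hwI (Nat.cast_nonneg (α := ℚ) m)
  have hf := mul_le_mul_of_nonneg_right hfloor (Nat.cast_nonneg (α := ℚ) I.card)
  have hfin : (∑ j ∈ B, ((I ∩ Finset.Ico (J j).r (J j).d).card : ℚ))
      ≤ I.card * (⌊4 / β * (m : ℚ)⌋₊ : ℚ) + ∑ j ∈ B, β * ((J j).lax : ℚ) := by
    linarith
  rw [← Finset.sum_congr rfl fun j _ => hlax' j] at hfin
  exact_mod_cast hfin
end

section
/- Let α ∈ (0,1) and let J be an instance with agreeable deadlines in which every job is α-tight (p_j > α·(d_j − r_j)), and suppose J admits a feasible nonpreemptive schedule on m machines. Then for every rational time t, the number of jobs j ∈ J with r_j + ℓ_j/2 ≤ t < d_j − ℓ_j/2 is at most (2·⌈1/α⌉ + 1)·m. (Equivalently, the MediumFit schedule, which runs each job j nonpreemptively during [r_j + ℓ_j/2, d_j − ℓ_j/2], uses at most (2·⌈1/α⌉ + 1)·m machines.) -/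
/-- A nonpreemptive schedule (given by start times) of `J` is feasible on `m` machines
if each job runs inside its window and at every time at most `m` jobs are running. -/
def FeasibleNP {n : ℕ} (J : Fin n → Job) (m : ℕ) : Prop :=
  ∃ s : Fin n → ℕ,
    (∀ j, (J j).r ≤ s j ∧ s j + (J j).p ≤ (J j).d) ∧
    (∀ t : ℕ, (Finset.univ.filter (fun j => s j ≤ t ∧ t < s j + (J j).p)).card ≤ m)

/-- The number of jobs running at a rational time is bounded if this holds at all integer times. -/
lemma card_running_le {n : ℕ} (s p : Fin n → ℕ) (m : ℕ)
    (h : ∀ t : ℕ, (Finset.univ.filter (fun j => s j ≤ t ∧ t < s j + p j)).card ≤ m) (y : ℚ) :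
    (Finset.univ.filter (fun j => (s j : ℚ) ≤ y ∧ y < (s j : ℚ) + (p j : ℚ))).card ≤ m := by
  refine (Finset.card_le_card fun j hj => ?_).trans (h ⌊y⌋₊)
  simp only [Finset.mem_filter, Finset.mem_univ, true_and] at hj ⊢
  have hy : 0 ≤ y := (Nat.cast_nonneg _).trans hj.1
  refine ⟨Nat.le_floor hj.1, (Nat.floor_lt hy).2 ?_⟩
  push_cast
  exact hj.2

/-- A half-open interval of length greater than `x`, at distance less than `N * x` from `t`,
contains a point `t + q * x` with `q` an integer in `[-N, N]`. -/
lemma exists_grid_point {s p t x : ℚ} {N : ℕ} (hx : 0 < x) (hp : x < p)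
    (hleft : t - (s + p) < N * x) (hright : s - t < N * x) :
    ∃ q ∈ Finset.Icc (-(N : ℤ)) N, s ≤ t + q * x ∧ t + q * x < s + p := by
  rcases lt_or_ge t s with hts | hts
  · have h1 : s - t ≤ ⌈(s - t) / x⌉ * x := (div_le_iff₀ hx).1 (Int.le_ceil _)
    have h2 : ⌈(s - t) / x⌉ * x < s - t + x := by
      have := mul_lt_mul_of_pos_right (Int.ceil_lt_add_one ((s - t) / x)) hx
      rwa [add_mul, div_mul_cancel₀ _ hx.ne', one_mul] at this
    have h3 : ⌈(s - t) / x⌉ ≤ (N : ℤ) := by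
      rw [Int.ceil_le]
      exact_mod_cast ((div_lt_iff₀ hx).2 hright).le
    have h4 : 0 ≤ ⌈(s - t) / x⌉ := Int.ceil_nonneg (div_nonneg (by linarith) hx.le)
    exact ⟨_, Finset.mem_Icc.2 ⟨by omega, h3⟩, by linarith, by linarith⟩
  · rcases lt_or_ge t (s + p) with htc | htc
    · exact ⟨0, Finset.mem_Icc.2 ⟨by omega, by omega⟩, by simpa using hts, by simpa using htc⟩
    · have h1 : ⌊(t - (s + p)) / x⌋ * x ≤ t - (s + p) := (le_div_iff₀ hx).1 (Int.floor_le _)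
      have h2 : t - (s + p) < (⌊(t - (s + p)) / x⌋ + 1) * x :=
        (div_lt_iff₀ hx).1 (Int.lt_floor_add_one _)
      have h3 : ⌊(t - (s + p)) / x⌋ < (N : ℤ) := by
        rw [Int.floor_lt]
        exact_mod_cast (div_lt_iff₀ hx).2 hleft
      have h4 : 0 ≤ ⌊(t - (s + p)) / x⌋ := Int.floor_nonneg.2 (div_nonneg (by linarith) hx.le)
      refine ⟨-(⌊(t - (s + p)) / x⌋ + 1), Finset.mem_Icc.2 ⟨by omega, by omega⟩, ?_, ?_⟩ <;>
        push_cast <;> linarith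

lemma Job.valid.cast_lax {j : Job} (h : j.valid) :
    (j.lax : ℚ) = (j.d : ℚ) - j.r - j.p := by
  have h2 := h.2
  rw [Job.lax, Nat.cast_sub (by omega), Nat.cast_sub (by omega)]


/-- If `J` has agreeable deadlines, every job is `α`-tight
(`p_j > α(d_j - r_j)`), and `J` admits a feasible nonpreemptive schedule on `m`
machines, then at every (rational) time `t` the number of jobs `j` with
`r_j + ℓ_j/2 ≤ t < d_j - ℓ_j/2` is at most `(2⌈1/α⌉ + 1)·m`; i.e. the MediumFit
schedule, which runs each job during the medium part `[r_j + ℓ_j/2, d_j - ℓ_j/2]` of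
its window, uses at most `(2⌈1/α⌉ + 1)·m` machines. -/
theorem mediumFit_agreeable_tight {n : ℕ} (J : Fin n → Job)
    (hval : ∀ j, (J j).valid)
    (hagree : ∀ j k, (J j).r < (J k).r → (J j).d ≤ (J k).d)
    (α : ℚ) (hα0 : 0 < α) (hα1 : α < 1)
    (htight : ∀ j, α * (((J j).d : ℚ) - ((J j).r : ℚ)) < ((J j).p : ℚ))
    (m : ℕ) (hm : FeasibleNP J m) :
    ∀ t : ℚ,
      (Finset.univ.filter (fun j =>
          ((J j).r : ℚ) + ((J j).lax : ℚ) / 2 ≤ t ∧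
          t < ((J j).d : ℚ) - ((J j).lax : ℚ) / 2)).card
        ≤ (2 * ⌈(1 / α : ℚ)⌉₊ + 1) * m := by
  intro t
  obtain ⟨s, hs, hcard⟩ := hm
  set A := Finset.univ.filter (fun j =>
    ((J j).r : ℚ) + ((J j).lax : ℚ) / 2 ≤ t ∧ t < ((J j).d : ℚ) - ((J j).lax : ℚ) / 2) with hA
  rcases A.eq_empty_or_nonempty with hemp | hne
  · simp [hemp]
  obtain ⟨i, hi, hmin⟩ := A.exists_min_image (fun j => ((J j).d : ℚ) - ((J j).r : ℚ)) hne
  set N := ⌈(1 / α : ℚ)⌉₊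
  set x := α * (((J i).d : ℚ) - ((J i).r : ℚ)) with hxdef
  have hpos : ∀ j, (1 : ℚ) ≤ (J j).p ∧ ((J j).r : ℚ) + (J j).p ≤ (J j).d := fun j =>
    ⟨by exact_mod_cast (hval j).1, by exact_mod_cast (hval j).2⟩
  have hwin : 0 < ((J i).d : ℚ) - ((J i).r : ℚ) := by linarith [(hpos i).1, (hpos i).2]
  have hx : 0 < x := mul_pos hα0 hwin
  have hNx : ((J i).d : ℚ) - ((J i).r : ℚ) ≤ N * x := by
    have h1 : 1 ≤ N * α := (div_le_iff₀ hα0).1 (Nat.le_ceil _)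
    rw [hxdef, ← mul_assoc]
    exact le_mul_of_one_le_left hwin.le h1
  have hmem : ∀ j ∈ A, (J j).r + (((J j).d : ℚ) - (J j).r - (J j).p) / 2 ≤ t ∧
      t < (J j).d - (((J j).d : ℚ) - (J j).r - (J j).p) / 2 := by
    intro j hj
    rw [hA, Finset.mem_filter, (hval j).cast_lax] at hj
    exact hj.2
  have hsub : A ⊆ (Finset.Icc (-(N : ℤ)) N).biUnion fun q => Finset.univ.filter fun j =>
      (s j : ℚ) ≤ t + q * x ∧ t + q * x < (s j : ℚ) + ((J j).p : ℚ) := by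
    intro j hj
    simp only [Finset.mem_biUnion, Finset.mem_filter, Finset.mem_univ, true_and]
    have hp : x < (J j).p :=
      (mul_le_mul_of_nonneg_left (hmin j hj) hα0.le).trans_lt (htight j)
    have hsr : ((J j).r : ℚ) ≤ s j := by exact_mod_cast (hs j).1
    have hsd : (s j : ℚ) + (J j).p ≤ (J j).d := by exact_mod_cast (hs j).2
    obtain ⟨hi1, hi2⟩ := hmem i hi
    obtain ⟨hj1, hj2⟩ := hmem j hj
    have hvi := hpos i
    have hvj := hpos j
    have hor : ((J i).r : ℚ) ≤ (J j).r ∨ ((J j).d : ℚ) ≤ (J i).d := by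
      rcases le_or_gt (J i).r (J j).r with h | h
      · exact Or.inl (by exact_mod_cast h)
      · exact Or.inr (by exact_mod_cast hagree j i h)
    apply exists_grid_point hx hp <;> refine lt_of_lt_of_le ?_ hNx <;>
      rcases hor with h | h <;> linarith
  calc A.card ≤ _ := Finset.card_le_card hsub
    _ ≤ (Finset.Icc (-(N : ℤ)) N).card * m :=
      Finset.card_biUnion_le_card_mul _ _ _ fun q _ =>
        card_running_le s (fun j => (J j).p) m hcard _
    _ = (2 * N + 1) * m := by
      rw [Int.card_Icc]
      congr 1
      omega
end

section
/- Let α ∈ (0,1) and let J be an instance in which all jobs have the same deadline d and every job is α-tight (p_j > α·(d − r_j)), and suppose J admits a feasible nonpreemptive schedule on m machines. Then for every time t, the number of jobs j ∈ J with r_j ≤ t < r_j + p_j is at most ⌈1/α⌉·m. (Equivalently, the EarlyFit schedule, which starts each job immediately at its release date, uses at most ⌈1/α⌉·m machines.) -/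
/-- An integer interval `[s, s + p)` reaching beyond `t`, ending by `t + T`, and with `T < k * p`
contains one of the points `t + ⌊i * T / k⌋` with `i < k`. -/
theorem exists_lt_equidistant_point_mem {k T t s p : ℕ} (hT : T < k * p)
    (hend : s + p ≤ t + T) (ht : t < s + p) :
    ∃ i < k, s ≤ t + i * T / k ∧ t + i * T / k < s + p := by
  have hk : 0 < k := Nat.pos_of_ne_zero (by rintro rfl; simp at hT)
  rcases Nat.le_total s t with hst | hst
  · exact ⟨0, hk, by simpa using hst, by simpa using ht⟩
  obtain ⟨u, rfl⟩ := Nat.exists_eq_add_of_le hst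
  have hT0 : 0 < T := by omega
  obtain ⟨i, hi₁, hi₂⟩ : ∃ i, u * k ≤ i * T ∧ i * T < u * k + T := by
    refine ⟨(u * k + (T - 1)) / T, ?_, ?_⟩
    · have := Nat.lt_div_mul_add (a := u * k + (T - 1)) hT0
      omega
    · have := Nat.div_mul_le_self (u * k + (T - 1)) T
      omega
  have hlt : i * T < (u + p) * k := by nlinarith
  refine ⟨i, ?_, ?_, ?_⟩
  · have : u + p ≤ T := by omega
    by_contra! h
    nlinarith [Nat.mul_le_mul_right T h, Nat.mul_le_mul_right k this]
  · have := (Nat.le_div_iff_mul_le hk).2 hi₁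
    omega
  · have := (Nat.div_lt_iff_lt_mul hk).2 hlt
    omega

/-- If all jobs of `J` have the same deadline `d`, every job is
`α`-tight (`p_j > α(d - r_j)`), and `J` admits a feasible nonpreemptive schedule on
`m` machines, then at every time `t` the number of jobs `j` with `r_j ≤ t < r_j + p_j`
is at most `⌈1/α⌉·m`; i.e. the EarlyFit schedule, which starts every job immediately
at its release date, uses at most `⌈1/α⌉·m` machines. -/
theorem earlyFit_uniform_deadline_tight {n : ℕ} (J : Fin n → Job)
    (hval : ∀ j, (J j).valid)
    (d : ℕ) (hd : ∀ j, (J j).d = d)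
    (α : ℚ) (hα0 : 0 < α) (hα1 : α < 1)
    (htight : ∀ j, α * ((d : ℚ) - ((J j).r : ℚ)) < ((J j).p : ℚ))
    (m : ℕ) (hm : FeasibleNP J m) :
    ∀ t : ℕ,
      (Finset.univ.filter (fun j => (J j).r ≤ t ∧ t < (J j).r + (J j).p)).card
        ≤ ⌈(1 / α : ℚ)⌉₊ * m := by
  intro t
  obtain ⟨s, hs, hcard⟩ := hm
  set k := ⌈(1 / α : ℚ)⌉₊
  have hkα : 1 ≤ (k : ℚ) * α := (div_le_iff₀ hα0).1 (Nat.le_ceil _)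
  have hsub : Finset.univ.filter (fun j => (J j).r ≤ t ∧ t < (J j).r + (J j).p) ⊆
      (Finset.range k).biUnion fun i => Finset.univ.filter fun j =>
        s j ≤ t + i * (d - t) / k ∧ t + i * (d - t) / k < s j + (J j).p := by
    intro j hj
    obtain ⟨hr, hp⟩ := (Finset.mem_filter.1 hj).2
    have hsj := hs j
    have hv := (hval j).2
    rw [hd j] at hsj hv
    have hlen : d - t < k * (J j).p := by
      have htd : t ≤ d := by omega
      have hrt : ((J j).r : ℚ) ≤ t := by exact_mod_cast hr
      have htd' : (t : ℚ) ≤ d := by exact_mod_cast htd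
      have hk0 : (0 : ℚ) < k := by
        exact_mod_cast Nat.ceil_pos.2 (one_div_pos.2 hα0)
      have : ((d - t : ℕ) : ℚ) < k * (J j).p := by
        rw [Nat.cast_sub htd]
        calc (d : ℚ) - t ≤ k * α * (d - t) :=
              le_mul_of_one_le_left (sub_nonneg.2 htd') hkα
          _ = k * (α * (d - t)) := mul_assoc _ _ _
          _ ≤ k * (α * (d - (J j).r)) := by gcongr
          _ < k * (J j).p := by gcongr; exact htight j
      exact_mod_cast this
    obtain ⟨i, hik, hi⟩ := exists_lt_equidistant_point_mem (t := t) (s := s j) hlen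
      (by omega) (by omega)
    exact Finset.mem_biUnion.2 ⟨i, Finset.mem_range.2 hik, by simpa using hi⟩
  calc _ ≤ _ := Finset.card_le_card hsub
    _ ≤ (Finset.range k).card * m := Finset.card_biUnion_le_card_mul _ _ _ fun i _ => hcard _
    _ = k * m := by rw [Finset.card_range]
end

section
/- Let J be an instance in which all jobs have equal processing time p, and suppose J admits a feasible nonpreemptive schedule on m machines. Call a job j critical if the interval [r_j, d_j] contains exactly one multiple of p, and non-critical otherwise. Then there exists a nonpreemptive schedule of J that is feasible on 2m machines in which every critical job j starts at time r_j, and every non-critical job j starts at a time s_j that is a multiple of p (so it is processed exactly within some interval [τ·p, (τ+1)·p]). -/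
/-- A job is critical (w.r.t. the common processing time `p`) if its window
`[r_j, d_j]` contains exactly one multiple of `p`. -/
def Critical (p : ℕ) (j : Job) : Prop :=
  ((Finset.Icc j.r j.d).filter (fun t => p ∣ t)).card = 1

/-- If a job started at `s` runs inside the window of `j`, and `j` is critical, then `j` is
released strictly after the last multiple of `p` up to `s`. -/
theorem Critical.div_mul_lt_release {p s : ℕ} {j : Job} (hp : 0 < p) (hd : s + p ≤ j.d)
    (hj : Critical p j) : s / p * p < j.r := by
  by_contra! h
  have hlt := Nat.lt_div_mul_add (a := s) hp
  have hle := Nat.div_mul_le_self s p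
  obtain ⟨a, ha⟩ := Finset.card_eq_one.mp hj
  have h₁ : s / p * p ∈ (Finset.Icc j.r j.d).filter (fun t => p ∣ t) := by
    simp only [Finset.mem_filter, Finset.mem_Icc]
    exact ⟨⟨h, by omega⟩, Dvd.intro_left _ rfl⟩
  have h₂ : s / p * p + p ∈ (Finset.Icc j.r j.d).filter (fun t => p ∣ t) := by
    simp only [Finset.mem_filter, Finset.mem_Icc]
    exact ⟨⟨by omega, by omega⟩, (Dvd.intro_left _ rfl).add dvd_rfl⟩
  rw [ha, Finset.mem_singleton] at h₁ h₂
  omega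

/-- If a non-critical job can start at `s`, then it fits into the slot of length `p`
containing `s` or into the next one. -/
theorem release_le_or_le_deadline_of_not_critical {p s : ℕ} {j : Job} (hp : 0 < p)
    (hr : j.r ≤ s) (hd : s + p ≤ j.d) (hj : ¬ Critical p j) :
    j.r ≤ s / p * p ∨ s / p * p + 2 * p ≤ j.d := by
  by_contra! h
  have hlt := Nat.lt_div_mul_add (a := s) hp
  have hle := Nat.div_mul_le_self s p
  refine hj (Finset.card_eq_one.mpr ⟨s / p * p + p, ?_⟩)
  ext t
  simp only [Finset.mem_filter, Finset.mem_Icc, Finset.mem_singleton]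
  constructor
  · rintro ⟨⟨h₁, h₂⟩, k, rfl⟩
    have hk₁ : s / p < k := by
      by_contra! hk
      have := Nat.mul_le_mul_left p hk
      linarith
    have hk₂ : k < s / p + 2 := by
      by_contra! hk
      have := Nat.mul_le_mul_left p hk
      linarith
    obtain rfl : k = s / p + 1 := by omega
    ring
  · rintro rfl
    exact ⟨⟨by omega, by omega⟩, (Dvd.intro_left _ rfl).add dvd_rfl⟩

/-- At most `m` jobs of length `p` start in a common slot of length `p`, if at most `m` jobs
run at any time: all of them run in the last time unit of the slot. -/
theorem card_filter_div_eq_le {ι : Type*} [Fintype ι] {p m : ℕ} (hp : 0 < p) (s : ι → ℕ)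
    (hs : ∀ t, (Finset.univ.filter (fun j => s j ≤ t ∧ t < s j + p)).card ≤ m) (k : ℕ) :
    (Finset.univ.filter (fun j => s j / p = k)).card ≤ m := by
  refine (Finset.card_le_card fun j hj => ?_).trans (hs (k * p + p - 1))
  simp only [Finset.mem_filter, Finset.mem_univ, true_and] at hj ⊢
  subst hj
  have hlt := Nat.lt_div_mul_add (a := s j) hp
  have hle := Nat.div_mul_le_self (s j) p
  omega

/-- Moving the start of every job so that each job runs inside the slot of
its former start and the next one, at most doubles the number of simultaneously running jobs. -/
theorem card_running_le_two_mul {ι : Type*} [Fintype ι] {p m : ℕ} (hp : 0 < p) (s s' : ι → ℕ)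
    (hs : ∀ t, (Finset.univ.filter (fun j => s j ≤ t ∧ t < s j + p)).card ≤ m)
    (hlo : ∀ j, s j / p * p ≤ s' j) (hhi : ∀ j, s' j ≤ s j / p * p + p) (t : ℕ) :
    (Finset.univ.filter (fun j => s' j ≤ t ∧ t < s' j + p)).card ≤ 2 * m := by
  classical
  have hsub : Finset.univ.filter (fun j => s' j ≤ t ∧ t < s' j + p) ⊆
      Finset.univ.filter (fun j => s j / p = t / p) ∪
        Finset.univ.filter (fun j => s j / p + 1 = t / p) := by
    intro j hj
    simp only [Finset.mem_filter, Finset.mem_univ, true_and, Finset.mem_union] at hj ⊢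
    have h₁ : s j / p ≤ t / p := (Nat.le_div_iff_mul_le hp).mpr ((hlo j).trans hj.1)
    have h₂ : t / p < s j / p + 2 := by
      rw [Nat.div_lt_iff_lt_mul hp]
      linarith [hhi j]
    omega
  have hprev : (Finset.univ.filter (fun j => s j / p + 1 = t / p)).card ≤ m := by
    refine (Finset.card_le_card (Finset.monotone_filter_right _ fun j _ hj => ?_)).trans
      (card_filter_div_eq_le hp s hs (t / p - 1))
    exact Nat.eq_sub_of_add_eq hj
  have hcur := card_filter_div_eq_le hp s hs (t / p)
  have hunion := (Finset.card_le_card hsub).trans (Finset.card_union_le _ _)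
  omega

/-- If all jobs of `J` have the same processing time `p` and `J`
admits a feasible nonpreemptive schedule on `m` machines, then there is a
nonpreemptive schedule of `J` feasible on `2m` machines in which every critical job
starts at its release date and every non-critical job starts at a multiple of `p`
(so it is processed within some interval `[τ·p, (τ+1)·p]`). -/
theorem structured_schedule_equal_processing {n : ℕ} (J : Fin n → Job)
    (hval : ∀ j, (J j).valid)
    (p : ℕ) (hp : ∀ j, (J j).p = p)
    (m : ℕ) (hm : FeasibleNP J m) :
    ∃ s : Fin n → ℕ,
      (∀ j, (J j).r ≤ s j ∧ s j + (J j).p ≤ (J j).d) ∧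
      (∀ t : ℕ, (Finset.univ.filter (fun j => s j ≤ t ∧ t < s j + (J j).p)).card
        ≤ 2 * m) ∧
      (∀ j, Critical p (J j) → s j = (J j).r) ∧
      (∀ j, ¬ Critical p (J j) → p ∣ s j) := by
  classical
  obtain ⟨s, hwin, hrun⟩ := hm
  have hpos : ∀ _ : Fin n, 0 < p := fun j => hp j ▸ (hval j).1
  simp only [hp] at hwin hrun ⊢
  rcases Nat.eq_zero_or_pos p with rfl | hp0
  · exact ⟨s, hwin, fun t => (hrun t).trans (by omega), fun j => absurd (hpos j) (lt_irrefl 0),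
      fun j => absurd (hpos j) (lt_irrefl 0)⟩
  have hlt : ∀ j, s j < s j / p * p + p := fun j => Nat.lt_div_mul_add hp0
  have hle : ∀ j, s j / p * p ≤ s j := fun j => Nat.div_mul_le_self _ _
  let s' : Fin n → ℕ := fun j =>
    if Critical p (J j) then (J j).r
    else if (J j).r ≤ s j / p * p then s j / p * p else s j / p * p + p
  have hs' : ∀ j, ((J j).r ≤ s' j ∧ s' j + p ≤ (J j).d) ∧
      s j / p * p ≤ s' j ∧ s' j ≤ s j / p * p + p := by
    intro j
    have := hlt j
    have := hle j
    have := hwin j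
    simp only [s']
    split_ifs with hc hr
    · have := hc.div_mul_lt_release hp0 (hwin j).2
      omega
    · omega
    · have := release_le_or_le_deadline_of_not_critical hp0 (hwin j).1 (hwin j).2 hc
      omega
  refine ⟨s', fun j => (hs' j).1,
    card_running_le_two_mul hp0 s s' hrun (fun j => (hs' j).2.1) fun j => (hs' j).2.2,
    fun j hc => if_pos hc, fun j hc => ?_⟩
  simp only [s', if_neg hc]
  split_ifs
  · exact Dvd.intro_left _ rfl
  · exact (Dvd.intro_left _ rfl).add dvd_rfl
end

section
/- Let α ∈ (0,1) and let J be an instance in which all jobs have equal processing time p and every job is α-tight (p > α·(d_j − r_j)). For a time t, define the density ρ(t) = p · max over integer intervals [a,b] with a < b of |{j ∈ J : r_j ≤ t, a ≤ r_j, d_j ≤ b}| / (b − a). Then for every time t, the number of jobs j ∈ J with r_j ≤ t < r_j + p is at most ⌊(1/α + 1)·ρ(t)⌋. (Equivalently, the EarlyFit schedule, which starts each job immediately at its release date, uses at most ⌊(1/α + 1)·ρ(t)⌋ machines at time t.) -/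
/-- The set of interval densities of the jobs of `J` released by time `t`:
for each integer interval `[a,b]` with `a < b`, the value
`p · |{j : r_j ≤ t, a ≤ r_j, d_j ≤ b}| / (b - a)`. The density `ρ(t)` is the greatest
element of this set. -/
def densitySet {n : ℕ} (J : Fin n → Job) (p : ℕ) (t : ℕ) : Set ℚ :=
  {q : ℚ | ∃ a b : ℕ, a < b ∧
    q = (p : ℚ) * ((Finset.univ.filter (fun j =>
          (J j).r ≤ t ∧ a ≤ (J j).r ∧ (J j).d ≤ b)).card : ℚ) / ((b : ℚ) - (a : ℚ))}

/-- If every release date precedes its deadline, the interval densities have a greatest element. -/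
theorem densitySet_exists_isGreatest {n : ℕ} (J : Fin n → Job)
    (hJ : ∀ j, (J j).r < (J j).d) (p t : ℕ) : ∃ ρ : ℚ, IsGreatest (densitySet J p t) ρ := by
  let count : ℕ → ℕ → ℕ := fun a b =>
    (Finset.univ.filter (fun j => (J j).r ≤ t ∧ a ≤ (J j).r ∧ (J j).d ≤ b)).card
  let density : ℕ × ℕ → ℚ := fun x => (p : ℚ) * (count x.1 x.2 : ℚ) / ((x.2 : ℚ) - (x.1 : ℚ))
  obtain ⟨M, hM0, hM⟩ : ∃ M : ℕ, 0 < M ∧ ∀ j, (J j).d ≤ M :=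
    ⟨(∑ j, (J j).d) + 1, Nat.succ_pos _, fun j =>
      (Finset.single_le_sum (f := fun j => (J j).d) (fun _ _ => Nat.zero_le _)
        (Finset.mem_univ j)).trans (Nat.le_succ _)⟩
  let S : Finset (ℕ × ℕ) :=
    (Finset.range (M + 1) ×ˢ Finset.range (M + 1)).filter (fun x => x.1 < x.2)
  have mem_S : ∀ a b, a < b → b ≤ M → (a, b) ∈ S := by
    intro a b hab hb
    simp only [S, Finset.mem_filter, Finset.mem_product, Finset.mem_range]
    omega
  obtain ⟨x, hxS, hx⟩ := S.exists_max_image density ⟨(0, M), mem_S 0 M hM0 le_rfl⟩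
  refine ⟨density x, ⟨x.1, x.2, (Finset.mem_filter.1 hxS).2, rfl⟩, ?_⟩
  rintro q ⟨a, b, hab, rfl⟩
  change density (a, b) ≤ density x
  rcases le_or_gt b M with hb | hb
  · exact hx _ (mem_S a b hab hb)
  rcases lt_or_ge a M with ha | ha
  · refine le_trans ?_ (hx _ (mem_S a M ha le_rfl))
    have hcount : count a b = count a M := by
      refine congrArg Finset.card (Finset.filter_congr fun j _ => ?_)
      have := hM j
      omega
    have ha' : (0 : ℚ) < (M : ℚ) - a := sub_pos.2 (by exact_mod_cast ha)
    have hb' : (M : ℚ) ≤ b := by exact_mod_cast hb.le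
    simp only [density, hcount]
    gcongr
  · refine le_trans ?_ (hx _ (mem_S 0 M hM0 le_rfl))
    have hcount : count a b = 0 := by
      refine Finset.card_eq_zero.2 (Finset.filter_eq_empty_iff.2 fun j _ => ?_)
      have := hM j
      have := hJ j
      omega
    simp only [density, hcount, Nat.cast_zero, mul_zero, zero_div, sub_zero]
    positivity

/-- If all jobs of `J` have the same processing time `p` and every
job is `α`-tight (`p > α(d_j - r_j)`), then for every time `t` the density
`ρ(t)` (the greatest interval density) exists and the number of jobs `j` with
`r_j ≤ t < r_j + p` is at most `⌊(1/α + 1)·ρ(t)⌋`; i.e. the EarlyFit schedule, which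
starts every job immediately at its release date, uses at most `⌊(1/α + 1)·ρ(t)⌋`
machines at time `t`. -/
theorem earlyFit_density_bound {n : ℕ} (J : Fin n → Job)
    (hval : ∀ j, (J j).valid)
    (p : ℕ) (hp : ∀ j, (J j).p = p)
    (α : ℚ) (hα0 : 0 < α) (hα1 : α < 1)
    (htight : ∀ j, α * (((J j).d : ℚ) - ((J j).r : ℚ)) < (p : ℚ)) :
    ∀ t : ℕ, ∃ ρ : ℚ, IsGreatest (densitySet J p t) ρ ∧
      (Finset.univ.filter (fun j => (J j).r ≤ t ∧ t < (J j).r + p)).card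
        ≤ ⌊(1 / α + 1) * ρ⌋₊ := by
  intro t
  have hlt : ∀ j, (J j).r < (J j).d := fun j => by
    have := hval j
    unfold Job.valid at this
    omega
  obtain ⟨ρ, hρ⟩ := densitySet_exists_isGreatest J hlt p t
  refine ⟨ρ, hρ, Nat.le_floor ?_⟩
  set A := Finset.univ.filter (fun j => (J j).r ≤ t ∧ t < (J j).r + p) with hA
  have hρ0 : 0 ≤ ρ := by
    refine le_trans ?_ (hρ.2 ⟨0, 1, Nat.zero_lt_one, rfl⟩)
    norm_num
    positivity
  rcases A.eq_empty_or_nonempty with hempty | hne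
  · rw [hempty, Finset.card_empty, Nat.cast_zero]
    positivity
  obtain ⟨j, hjA, hj⟩ := A.exists_max_image (fun j => (J j).d) hne
  have hjA' := (Finset.mem_filter.1 hjA).2
  have hp0 : 0 < p := by omega
  have hab : t + 1 - p < (J j).d := by
    have := hlt j
    omega
  have hmem := hρ.2 ⟨t + 1 - p, (J j).d, hab, rfl⟩
  have hcard : A.card ≤ (Finset.univ.filter (fun i =>
      (J i).r ≤ t ∧ t + 1 - p ≤ (J i).r ∧ (J i).d ≤ (J j).d)).card := by
    refine Finset.card_le_card fun i hi => Finset.mem_filter.2 ⟨Finset.mem_univ i, ?_⟩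
    have := (Finset.mem_filter.1 hi).2
    have := hj i hi
    omega
  have hpos : (0 : ℚ) < ((J j).d : ℚ) - ((t + 1 - p : ℕ) : ℚ) :=
    sub_pos.2 (by exact_mod_cast hab)
  have hp0' : (0 : ℚ) < p := by exact_mod_cast hp0
  have hlen : ((J j).d : ℚ) - ((t + 1 - p : ℕ) : ℚ) ≤ (1 / α + 1) * p := by
    have hwindow : ((J j).d : ℚ) - (J j).r ≤ p / α := by
      rw [le_div_iff₀ hα0, mul_comm]
      exact (htight j).le
    have hstart : ((J j).r : ℚ) ≤ ((t + 1 - p : ℕ) : ℚ) + p := by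
      have : (J j).r ≤ (t + 1 - p) + p := by omega
      exact_mod_cast this
    calc ((J j).d : ℚ) - ((t + 1 - p : ℕ) : ℚ) ≤ p / α + p := by linarith
      _ = (1 / α + 1) * p := by ring
  rw [div_le_iff₀ hpos] at hmem
  refine le_of_mul_le_mul_left ?_ hp0'
  calc (p : ℚ) * A.card ≤ _ := by gcongr
    _ ≤ ρ * (((J j).d : ℚ) - ((t + 1 - p : ℕ) : ℚ)) := hmem
    _ ≤ ρ * ((1 / α + 1) * p) := by gcongr
    _ = p * ((1 / α + 1) * ρ) := by ring
end
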